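/- arXiv:2507.23045 — 5 statements merged into one kernel-verified Lean document; each statement's English description precedes it below -/
import Mathlib

section
/- Let a generalized rotation-only RWHEC instance be given on a weakly connected bipartite directed graph with exact measurements. If two feasible rotation assignments (R_X, R_Y) and (R'_X, R'_Y) agree at a single vertex (that is, R_X(v) = R'_X(v) for some v ∈ V_X, or R_Y(v) = R'_Y(v) for some v ∈ V_Y), then they agree at every vertex: R_X(j) = R'_X(j) for all j ∈ V_X and R_Y(k) = R'_Y(k) for all k ∈ V_Y. Consequently, if the rotation at a single vertex is uniquely determined by the problem data, the instance has at most one feasible assignment. -/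
open Matrix

/-- `SO(3)`: real 3×3 matrices `R` with `RᵀR = I` and `det R = 1`. -/
def SO3 : Set (Matrix (Fin 3) (Fin 3) ℝ) := {R | Rᵀ * R = 1 ∧ R.det = 1}

/-- The undirected bipartite graph on `VX ⊕ VY` obtained from the directed edge set
`E ⊆ VX × VY` by forgetting orientations. -/
def bipGraph {VX VY : Type*} (E : Finset (VX × VY)) : SimpleGraph (VX ⊕ VY) :=
  SimpleGraph.fromRel (fun a b => ∃ p ∈ E, a = Sum.inl p.1 ∧ b = Sum.inr p.2)

/-- Elements of `SO3` are units of the matrix ring. -/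
lemma isUnit_of_mem_SO3 {R : Matrix (Fin 3) (Fin 3) ℝ} (hR : R ∈ SO3) : IsUnit R :=
  (Matrix.isUnit_iff_isUnit_det R).2 (by rw [hR.2]; exact isUnit_one)

/-- A predicate on the vertices of a connected graph that is invariant along edges and holds
at one vertex holds at every vertex. -/
lemma SimpleGraph.Connected.forall_of_adj_iff {V : Type*} {G : SimpleGraph V}
    (hG : G.Connected) {P : V → Prop} (hP : ∀ a b, G.Adj a b → (P a ↔ P b))
    {v : V} (hv : P v) (w : V) : P w := by
  obtain ⟨p⟩ := hG.preconnected v w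
  induction p with
  | nil => exact hv
  | cons h _ ih => exact ih ((hP _ _ h).1 hv)

/-- In a generalized rotation-only RWHEC instance on a weakly connected
bipartite directed graph with exact measurements, if two feasible rotation assignments agree
at a single vertex, then they agree at every vertex. -/
theorem rwhec_rotation_agree_of_agree_at_vertex
    {VX VY : Type*} [Fintype VX] [Fintype VY] [Nonempty VX] [Nonempty VY]
    (E : Finset (VX × VY))
    (hconn : (bipGraph E).Connected)
    (N : VX × VY → ℕ) (hN : ∀ e ∈ E, 1 ≤ N e)
    (A B : (e : VX × VY) → Fin (N e) → Matrix (Fin 3) (Fin 3) ℝ)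
    (hA : ∀ e ∈ E, ∀ i, A e i ∈ SO3)
    (hB : ∀ e ∈ E, ∀ i, B e i ∈ SO3)
    (RX RX' : VX → Matrix (Fin 3) (Fin 3) ℝ)
    (RY RY' : VY → Matrix (Fin 3) (Fin 3) ℝ)
    (hRX : ∀ j, RX j ∈ SO3) (hRY : ∀ k, RY k ∈ SO3)
    (hRX' : ∀ j, RX' j ∈ SO3) (hRY' : ∀ k, RY' k ∈ SO3)
    (hfeas : ∀ e ∈ E, ∀ i, A e i * RX e.1 = RY e.2 * B e i)
    (hfeas' : ∀ e ∈ E, ∀ i, A e i * RX' e.1 = RY' e.2 * B e i)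
    (hagree : (∃ v, RX v = RX' v) ∨ (∃ v, RY v = RY' v)) :
    (∀ j, RX j = RX' j) ∧ (∀ k, RY k = RY' k) := by
  have edge : ∀ e ∈ E, (RX e.1 = RX' e.1 ↔ RY e.2 = RY' e.2) := by
    intro e he
    let i : Fin (N e) := ⟨0, hN e he⟩
    rw [← (isUnit_of_mem_SO3 (hA e he i)).mul_right_inj, hfeas e he i, hfeas' e he i,
      (isUnit_of_mem_SO3 (hB e he i)).mul_left_inj]
  let P : VX ⊕ VY → Prop := Sum.elim (fun j => RX j = RX' j) (fun k => RY k = RY' k)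
  have hP : ∀ a b, (bipGraph E).Adj a b → (P a ↔ P b) := by
    intro a b hab
    rw [bipGraph, SimpleGraph.fromRel_adj] at hab
    rcases hab with ⟨-, ⟨e, he, rfl, rfl⟩ | ⟨e, he, rfl, rfl⟩⟩
    · exact edge e he
    · exact (edge e he).symm
  obtain ⟨v, hv⟩ : ∃ v, P v := by
    rcases hagree with ⟨v, hv⟩ | ⟨v, hv⟩
    · exact ⟨Sum.inl v, hv⟩
    · exact ⟨Sum.inr v, hv⟩
  have all := hconn.forall_of_adj_iff hP hv
  exact ⟨fun j => all (Sum.inl j), fun k => all (Sum.inr k)⟩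
end

section
/- Let a generalized standard RWHEC instance be given on a weakly connected bipartite directed graph with exact pose measurements. If two feasible pose assignments agree at a single vertex (that is, (R_X(v), t_X(v)) = (R'_X(v), t'_X(v)) for some v ∈ V_X, or (R_Y(v), t_Y(v)) = (R'_Y(v), t'_Y(v)) for some v ∈ V_Y), then they agree at every vertex. Consequently, if the pose at a single vertex is uniquely determined by the problem data, the instance has at most one feasible pose assignment. -/
open Matrix

theorem SO3.isUnit {R : Matrix (Fin 3) (Fin 3) ℝ} (h : R ∈ SO3) : IsUnit R :=
  IsUnit.of_mul_eq_one_right _ h.1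

/-- A vertex predicate that is equivalent across every edge of a connected bipartite graph holds
everywhere as soon as it holds at one vertex. -/
theorem forall_of_bipGraph_connected {VX VY : Type*} {E : Finset (VX × VY)}
    (hconn : (bipGraph E).Connected) {P : VX ⊕ VY → Prop}
    (hP : ∀ e ∈ E, P (Sum.inl e.1) ↔ P (Sum.inr e.2)) {u : VX ⊕ VY} (hu : P u)
    (v : VX ⊕ VY) : P v := by
  obtain ⟨w⟩ := hconn.preconnected u v
  induction w with
  | nil => exact hu
  | cons hadj _ ih =>
    refine ih ?_
    obtain ⟨-, ⟨e, he, rfl, rfl⟩ | ⟨e, he, rfl, rfl⟩⟩ := (SimpleGraph.fromRel_adj _ _ _).1 hadj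
    · exact (hP e he).1 hu
    · exact (hP e he).2 hu

/-- Across a single exact measurement, two feasible pose pairs agree at one endpoint if and only
if they agree at the other. -/
theorem pose_agree_iff_of_measurement {A B X X' Y Y' : Matrix (Fin 3) (Fin 3) ℝ}
    {a b x x' y y' : Fin 3 → ℝ} (hA : IsUnit A) (hB : IsUnit B)
    (hR : A * X = Y * B) (ht : A.mulVec x + a = Y.mulVec b + y)
    (hR' : A * X' = Y' * B) (ht' : A.mulVec x' + a = Y'.mulVec b + y') :
    (X = X' ∧ x = x') ↔ (Y = Y' ∧ y = y') := by
  constructor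
  · rintro ⟨rfl, rfl⟩
    obtain rfl : Y = Y' := hB.mul_right_cancel (hR.symm.trans hR')
    exact ⟨rfl, add_left_cancel (ht.symm.trans ht')⟩
  · rintro ⟨rfl, rfl⟩
    exact ⟨hA.mul_left_cancel (hR.trans hR'.symm),
      Matrix.mulVec_injective_of_isUnit hA (add_right_cancel (ht.trans ht'.symm))⟩

/-- In a generalized standard RWHEC instance on a weakly connected
bipartite directed graph with exact pose measurements, if two feasible pose assignments
agree at a single vertex, then they agree at every vertex. -/
theorem rwhec_pose_agree_of_agree_at_vertex
    {VX VY : Type*} [Fintype VX] [Fintype VY] [Nonempty VX] [Nonempty VY]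
    (E : Finset (VX × VY))
    (hconn : (bipGraph E).Connected)
    (N : VX × VY → ℕ) (hN : ∀ e ∈ E, 1 ≤ N e)
    (RA RB : (e : VX × VY) → Fin (N e) → Matrix (Fin 3) (Fin 3) ℝ)
    (tA tB : (e : VX × VY) → Fin (N e) → (Fin 3 → ℝ))
    (hRA : ∀ e ∈ E, ∀ i, RA e i ∈ SO3)
    (hRB : ∀ e ∈ E, ∀ i, RB e i ∈ SO3)
    (RX RX' : VX → Matrix (Fin 3) (Fin 3) ℝ) (tX tX' : VX → (Fin 3 → ℝ))
    (RY RY' : VY → Matrix (Fin 3) (Fin 3) ℝ) (tY tY' : VY → (Fin 3 → ℝ))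
    (hRX : ∀ j, RX j ∈ SO3) (hRY : ∀ k, RY k ∈ SO3)
    (hRX' : ∀ j, RX' j ∈ SO3) (hRY' : ∀ k, RY' k ∈ SO3)
    (hfeasR : ∀ e ∈ E, ∀ i, RA e i * RX e.1 = RY e.2 * RB e i)
    (hfeast : ∀ e ∈ E, ∀ i,
      (RA e i).mulVec (tX e.1) + tA e i = (RY e.2).mulVec (tB e i) + tY e.2)
    (hfeasR' : ∀ e ∈ E, ∀ i, RA e i * RX' e.1 = RY' e.2 * RB e i)
    (hfeast' : ∀ e ∈ E, ∀ i,
      (RA e i).mulVec (tX' e.1) + tA e i = (RY' e.2).mulVec (tB e i) + tY' e.2)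
    (hagree : (∃ v, RX v = RX' v ∧ tX v = tX' v) ∨ (∃ v, RY v = RY' v ∧ tY v = tY' v)) :
    (∀ j, RX j = RX' j ∧ tX j = tX' j) ∧ (∀ k, RY k = RY' k ∧ tY k = tY' k) := by
  let P : VX ⊕ VY → Prop :=
    Sum.elim (fun j => RX j = RX' j ∧ tX j = tX' j) (fun k => RY k = RY' k ∧ tY k = tY' k)
  have hP : ∀ e ∈ E, P (Sum.inl e.1) ↔ P (Sum.inr e.2) := fun e he =>
    let i : Fin (N e) := ⟨0, hN e he⟩
    pose_agree_iff_of_measurement (SO3.isUnit (hRA e he i)) (SO3.isUnit (hRB e he i))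
      (hfeasR e he i) (hfeast e he i) (hfeasR' e he i) (hfeast' e he i)
  obtain ⟨u, hu⟩ : ∃ u, P u := by
    rcases hagree with ⟨v, hv⟩ | ⟨v, hv⟩
    · exact ⟨Sum.inl v, hv⟩
    · exact ⟨Sum.inr v, hv⟩
  have hall := forall_of_bipGraph_connected hconn hP hu
  exact ⟨fun j => hall (Sum.inl j), fun k => hall (Sum.inr k)⟩
end

section
/- Let g : M₃(ℝ) → M₃(ℝ) × M₃(ℝ) × (ℝ³)³ be the quadratic constraint map g(R) = (R Rᵀ − I, Rᵀ R − I, (R_{σ(1)} × R_{σ(2)} − R_{σ(3)})_{σ}), where R_i denotes the i-th column of R, × is the cross product on ℝ³, and σ ranges over the three cyclic permutations of (1,2,3). Then the zero set of g equals SO(3) = {R ∈ M₃(ℝ) : RᵀR = I, det R = 1}, and for every R ∈ SO(3) the Abadie constraint qualification holds at R: the tangent cone of the zero set of g at R equals the kernel of the Fréchet derivative of g at R. -/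
open Matrix

attribute [local instance]
  Matrix.frobeniusNormedAddCommGroup Matrix.frobeniusNormedSpace

/-- The quadratic constraint map
`g(R) = (R Rᵀ − I, Rᵀ R − I, (R_{σ(1)} × R_{σ(2)} − R_{σ(3)})_σ)`, where `σ` ranges over the
three cyclic permutations of `(1,2,3)` (encoded by the offset `c : Fin 3`, so that
`σ_c = (c, c+1, c+2)`), and `R_j` denotes the `j`-th column of `R`. -/
def gSO3 (R : Matrix (Fin 3) (Fin 3) ℝ) :
    Matrix (Fin 3) (Fin 3) ℝ × Matrix (Fin 3) (Fin 3) ℝ × (Fin 3 → Fin 3 → ℝ) :=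
  (R * Rᵀ - 1, Rᵀ * R - 1,
    fun c => crossProduct (fun r => R r c) (fun r => R r (c + 1)) - fun r => R r (c + 2))

/-- A matrix of determinant one whose transpose is a left inverse has adjugate equal to its
transpose. -/
theorem adjugate_eq_transpose_of_mem_SO3 {R : Matrix (Fin 3) (Fin 3) ℝ} (hR : R ∈ SO3) :
    R.adjugate = Rᵀ := by
  obtain ⟨h, hdet⟩ := hR
  have h' : R * Rᵀ = 1 := mul_eq_one_comm.mp h
  calc R.adjugate = R.adjugate * (R * Rᵀ) := by rw [h', mul_one]
    _ = Rᵀ := by rw [← mul_assoc, adjugate_mul, hdet, one_smul, one_mul]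

theorem gSO3_eq_zero_iff (R : Matrix (Fin 3) (Fin 3) ℝ) : gSO3 R = 0 ↔ R ∈ SO3 := by
  constructor
  · intro h
    have h₂ : Rᵀ * R = 1 := sub_eq_zero.mp (congrArg (fun p => p.2.1) h)
    have hc (r : Fin 3) := congrFun (congrFun (congrArg (fun p => p.2.2) h) 0) r
    have h22 := congrFun (congrFun h₂ 2) 2
    have hc0 := hc 0
    have hc1 := hc 1
    have hc2 := hc 2
    simp [gSO3, cross_apply, vecHead, vecTail] at hc0 hc1 hc2
    simp [mul_apply, Fin.sum_univ_three] at h22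
    refine ⟨h₂, ?_⟩
    rw [det_fin_three]
    linear_combination R 0 2 * hc0 + R 1 2 * hc1 + R 2 2 * hc2 + h22
  · intro hR
    have hadj := adjugate_eq_transpose_of_mem_SO3 hR
    rw [adjugate_fin_three] at hadj
    have hentry (i j : Fin 3) := congrFun (congrFun hadj i) j
    have h₁ : R * Rᵀ - 1 = 0 := sub_eq_zero.mpr (mul_eq_one_comm.mp hR.1)
    have h₂ : Rᵀ * R - 1 = 0 := sub_eq_zero.mpr hR.1
    refine Prod.ext h₁ (Prod.ext h₂ ?_)
    funext c r
    have := hentry (c + 2) r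
    fin_cases c <;> fin_cases r <;> simp [gSO3, cross_apply, vecHead, vecTail] at this ⊢ <;>
      linarith

section Calculus

attribute [local instance] Matrix.frobeniusNormedRing Matrix.frobeniusNormedAlgebra

/-- Transposition as a continuous linear map. -/
noncomputable def transposeCLM :
    Matrix (Fin 3) (Fin 3) ℝ →L[ℝ] Matrix (Fin 3) (Fin 3) ℝ :=
  (transposeLinearEquiv (Fin 3) (Fin 3) ℝ ℝ).toLinearMap.toContinuousLinearMap

theorem hasFDerivAt_transpose (R : Matrix (Fin 3) (Fin 3) ℝ) :
    HasFDerivAt (fun M : Matrix (Fin 3) (Fin 3) ℝ => Mᵀ) transposeCLM R :=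
  transposeCLM.hasFDerivAt

theorem differentiableAt_entry (i j : Fin 3) (R : Matrix (Fin 3) (Fin 3) ℝ) :
    DifferentiableAt ℝ (fun M : Matrix (Fin 3) (Fin 3) ℝ => M i j) R :=
  (entryLinearMap ℝ ℝ i j).toContinuousLinearMap.differentiableAt

theorem differentiableAt_gSO3 (R : Matrix (Fin 3) (Fin 3) ℝ) : DifferentiableAt ℝ gSO3 R := by
  have ht := (hasFDerivAt_transpose R).differentiableAt
  refine ((differentiableAt_id.mul ht).sub_const 1).prodMk
    (((ht.mul differentiableAt_id).sub_const 1).prodMk ?_)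
  refine differentiableAt_pi.mpr fun c => differentiableAt_pi.mpr fun r => ?_
  have he := differentiableAt_entry
  fin_cases r <;> simp only [cross_apply, Pi.sub_apply] <;>
    exact (((he _ _ R).mul (he _ _ R)).sub ((he _ _ R).mul (he _ _ R))).sub (he _ _ R)

theorem fderiv_gSO3_apply_snd_fst (R H : Matrix (Fin 3) (Fin 3) ℝ) :
    (fderiv ℝ gSO3 R H).2.1 = Rᵀ * H + Hᵀ * R := by
  have h₁ := (differentiableAt_gSO3 R).hasFDerivAt.snd.fst
  have h₂ := ((hasFDerivAt_transpose R).mul' (hasFDerivAt_id R)).sub_const 1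
  exact DFunLike.congr_fun (h₁.unique h₂) H

theorem exp_mem_SO3 {A : Matrix (Fin 3) (Fin 3) ℝ} (hA : Aᵀ = -A) : NormedSpace.exp A ∈ SO3 := by
  have hexp {B : Matrix (Fin 3) (Fin 3) ℝ} (hB : Bᵀ = -B) :
      (NormedSpace.exp B)ᵀ * NormedSpace.exp B = 1 := by
    rw [← exp_transpose, hB, ← exp_add_of_commute _ _ (Commute.neg_left (Commute.refl B)),
      neg_add_cancel, NormedSpace.exp_zero]
  refine ⟨hexp hA, ?_⟩
  have hhalf := congrArg det (hexp (B := (1 / 2 : ℝ) • A) (by rw [transpose_smul, hA, smul_neg]))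
  rw [det_mul, det_transpose, det_one] at hhalf
  rw [← hhalf, ← det_mul, ← exp_add_of_commute _ _ (Commute.refl _), ← add_smul]
  norm_num

theorem SO3_mul_mem {R Q : Matrix (Fin 3) (Fin 3) ℝ} (hR : R ∈ SO3) (hQ : Q ∈ SO3) :
    R * Q ∈ SO3 := by
  refine ⟨?_, by rw [det_mul, hR.2, hQ.2, one_mul]⟩
  rw [transpose_mul, mul_assoc, ← mul_assoc Rᵀ, hR.1, one_mul, hQ.1]

/-- Tangent vectors to the geodesics `t ↦ R exp(tA)` lie in the tangent cone of `SO(3)`. -/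
theorem mul_mem_tangentConeAt_SO3 {R A : Matrix (Fin 3) (Fin 3) ℝ} (hR : R ∈ SO3)
    (hA : Aᵀ = -A) : R * A ∈ tangentConeAt ℝ SO3 R := by
  have hd : HasDerivAt (fun t : ℝ => R * NormedSpace.exp (t • A)) (R * A) 0 := by
    have h := (hasDerivAt_exp_smul_const A (0 : ℝ)).const_mul R
    rw [zero_smul, NormedSpace.exp_zero, one_mul] at h
    exact h
  have hmaps := hd.hasFDerivAt.hasFDerivWithinAt (s := Set.univ) |>.mapsTo_tangent_cone
  rw [tangentConeAt_univ, zero_smul, NormedSpace.exp_zero, mul_one] at hmaps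
  have hmem : (1 : ℝ) • (R * A) ∈ _ := hmaps (Set.mem_univ 1)
  rw [one_smul] at hmem
  refine tangentConeAt_mono ?_ hmem
  rintro _ ⟨t, -, rfl⟩
  exact SO3_mul_mem hR (exp_mem_SO3 (by rw [transpose_smul, hA, smul_neg]))

end Calculus

/-- The zero set of the quadratic constraint map `g` is exactly `SO(3)`,
and at every `R ∈ SO(3)` the Abadie constraint qualification holds: the tangent cone of the
zero set of `g` at `R` equals the kernel of the Fréchet derivative of `g` at `R`. -/
theorem so3_constraints_abadie :
    {R : Matrix (Fin 3) (Fin 3) ℝ | gSO3 R = 0} = SO3 ∧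
    ∀ R ∈ SO3, tangentConeAt ℝ {M | gSO3 M = 0} R = {H | fderiv ℝ gSO3 R H = 0} := by
  have hzero : {R : Matrix (Fin 3) (Fin 3) ℝ | gSO3 R = 0} = SO3 := Set.ext gSO3_eq_zero_iff
  refine ⟨hzero, fun R hR => Set.Subset.antisymm (fun H hH => ?_) fun H hH => ?_⟩
  · have hmem := (differentiableAt_gSO3 R).hasFDerivAt.hasFDerivWithinAt.mapsTo_tangent_cone hH
    have himage : gSO3 '' {M | gSO3 M = 0} ⊆ {0} := by
      rintro _ ⟨M, hM, rfl⟩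
      exact hM
    exact tangentConeAt_subset_zero
      (fun hacc => Set.Infinite.of_accPt hacc (Set.finite_singleton 0)) (tangentConeAt_mono himage hmem)
  · have hskew : Rᵀ * H + Hᵀ * R = 0 := by
      rw [← fderiv_gSO3_apply_snd_fst, show fderiv ℝ gSO3 R H = 0 from hH]
      rfl
    have hA : (Rᵀ * H)ᵀ = -(Rᵀ * H) := by
      rw [transpose_mul, transpose_transpose]
      exact eq_neg_of_add_eq_zero_right hskew
    have hmem := mul_mem_tangentConeAt_SO3 hR hA
    rwa [← mul_assoc, mul_eq_one_comm.mp hR.1, one_mul, ← hzero] at hmem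
end

section
/- Let c₁ : ℝⁿ → ℝ^{m₁} be continuously differentiable on a neighborhood of a point x̄ ∈ ℝⁿ, and suppose the Fréchet derivative Dc₁(x̄) : ℝⁿ → ℝ^{m₁} is surjective. Let X = {x ∈ ℝⁿ : c₁(x) = c₁(x̄)} be the level set of c₁ through x̄. Then the tangent cone of X at x̄ equals the kernel of Dc₁(x̄); in particular, X is locally, near x̄, a smooth embedded submanifold of ℝⁿ of dimension n − m₁ with tangent space ker Dc₁(x̄) at x̄. -/
open Topology

/-- Every tangent vector to a level set lies in the kernel of the derivative. -/
theorem HasFDerivAt.tangentConeAt_levelSet_subset_ker {𝕜 E F : Type*}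
    [NontriviallyNormedField 𝕜] [NormedAddCommGroup E] [NormedSpace 𝕜 E]
    [NormedAddCommGroup F] [NormedSpace 𝕜 F] {f : E → F} {f' : E →L[𝕜] F} {a : E}
    (hf : HasFDerivAt f f' a) :
    tangentConeAt 𝕜 {x | f x = f a} a ⊆ f'.ker := fun _ hv =>
  hf.hasFDerivWithinAt.unique_on
    ((hasFDerivWithinAt_const (f a) a _).congr (fun _ hx => hx) rfl) hv

/-- If the strict derivative is surjective, every vector in its kernel is tangent to the
level set, the implicit function being a parametrization of it. -/
theorem HasStrictFDerivAt.ker_subset_tangentConeAt_levelSet {𝕜 E F : Type*}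
    [NontriviallyNormedField 𝕜] [CompleteSpace 𝕜] [NormedAddCommGroup E] [NormedSpace 𝕜 E]
    [CompleteSpace E] [NormedAddCommGroup F] [NormedSpace 𝕜 F] [FiniteDimensional 𝕜 F]
    {f : E → F} {f' : E →L[𝕜] F} {a : E}
    (hf : HasStrictFDerivAt f f' a) (hf' : f'.range = ⊤) :
    (f'.ker : Set E) ⊆ tangentConeAt 𝕜 {x | f x = f a} a := by
  intro v hv
  set g : f'.ker → E := hf.implicitFunction f f' hf' (f a)
  have hg : {k | f (g k) = f a} ∈ 𝓝 (0 : f'.ker) :=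
    (hf.map_implicitFunction_eq hf').curry_nhds.self_of_nhds
  have hmaps := ((hf.to_implicitFunction hf').hasFDerivAt.hasFDerivWithinAt
    (s := {k | f (g k) = f a})).mapsTo_tangent_cone
  rw [tangentConeAt_of_mem_nhds hg, hf.implicitFunction_apply_image hf'] at hmaps
  exact tangentConeAt_mono (Set.image_subset_iff.2 fun _ hk => hk)
    (hmaps (Set.mem_univ (⟨v, hv⟩ : f'.ker)))

/-- If `c₁ : ℝⁿ → ℝ^{m₁}` is continuously differentiable on a
neighborhood of `x0` and its Fréchet derivative at `x0` is surjective, then the tangent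
cone at `x0` of the level set `X = {x : c₁ x = c₁ x0}` equals the kernel of `D c₁(x0)`
(so that `X` is locally a smooth embedded submanifold of dimension `n − m₁` with this
tangent space at `x0`). -/
theorem tangentCone_levelSet_of_surjective_fderiv {n m₁ : ℕ}
    (c₁ : EuclideanSpace ℝ (Fin n) → EuclideanSpace ℝ (Fin m₁))
    (x0 : EuclideanSpace ℝ (Fin n))
    (hc₁ : ContDiffAt ℝ 1 c₁ x0)
    (hsurj : Function.Surjective ⇑(fderiv ℝ c₁ x0)) :
    tangentConeAt ℝ {x | c₁ x = c₁ x0} x0 = {v | fderiv ℝ c₁ x0 v = 0} := by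
  have hf : HasStrictFDerivAt c₁ (fderiv ℝ c₁ x0) x0 := hc₁.hasStrictFDerivAt one_ne_zero
  exact hf.hasFDerivAt.tangentConeAt_levelSet_subset_ker.antisymm
    (hf.ker_subset_tangentConeAt_levelSet (LinearMap.range_eq_top.2 hsurj))
end

section
/- Let c₁ : ℝⁿ → ℝ^{m₁} and c₂ : ℝⁿ → ℝ^{m₂} be continuously differentiable on a neighborhood of x̄ ∈ ℝⁿ, suppose Dc₁(x̄) is surjective, and suppose c₂ is locally constant on the level set X = {x : c₁(x) = c₁(x̄)} near x̄, i.e., there is an open set V containing x̄ with c₂(x) = c₂(x̄) for all x ∈ X ∩ V. Let c = (c₁, c₂) : ℝⁿ → ℝ^{m₁+m₂} and M = {x ∈ ℝⁿ : c(x) = c(x̄)}. Then: (i) M ∩ V = X ∩ V; (ii) ker Dc(x̄) = ker Dc₁(x̄); and (iii) the tangent cone of M at x̄ equals ker Dc(x̄). In particular, the Abadie constraint qualification holds for c at x̄. -/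
open Set Filter Topology

/-- Tangent vectors to a level set are annihilated by the derivative. -/
theorem HasFDerivAt.apply_eq_zero_of_mem_tangentConeAt_levelSet {E F : Type*}
    [NormedAddCommGroup E] [NormedSpace ℝ E] [NormedAddCommGroup F] [NormedSpace ℝ F]
    {f : E → F} {f' : E →L[ℝ] F} {a v : E} (hf : HasFDerivAt f f' a)
    (hv : v ∈ tangentConeAt ℝ {x | f x = f a} a) : f' v = 0 := by
  have hmem := hf.hasFDerivWithinAt.mapsTo_tangent_cone hv
  have himage : f '' {x | f x = f a} ⊆ {f a} := by
    rintro _ ⟨x, hx, rfl⟩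
    exact hx
  have hacc : ¬AccPt (f a) (𝓟 {f a}) := by
    rw [accPt_iff_frequently]
    simp
  exact tangentConeAt_subset_zero hacc (tangentConeAt_mono himage hmem)

/-- At a regular point, every vector in the kernel of the derivative is tangent to the
level set. -/
theorem HasStrictFDerivAt.mem_tangentConeAt_levelSet {E F : Type*}
    [NormedAddCommGroup E] [NormedSpace ℝ E] [CompleteSpace E]
    [NormedAddCommGroup F] [NormedSpace ℝ F] [FiniteDimensional ℝ F]
    {f : E → F} {f' : E →L[ℝ] F} {a v : E} (hf : HasStrictFDerivAt f f' a)
    (hsurj : Function.Surjective f') (hv : f' v = 0) :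
    v ∈ tangentConeAt ℝ {x | f x = f a} a := by
  have hrange : f'.range = ⊤ := LinearMap.range_eq_top.2 hsurj
  set g := hf.implicitFunction f f' hrange (f a)
  have hlevel : {y | f (g y) = f a} ∈ 𝓝 (0 : f'.ker) :=
    (tendsto_const_nhds.prodMk_nhds tendsto_id).eventually (hf.map_implicitFunction_eq hrange)
  have hmem : (⟨v, hv⟩ : f'.ker) ∈ tangentConeAt ℝ {y | f (g y) = f a} 0 := by
    simp [tangentConeAt_of_mem_nhds hlevel]
  have himage := (hf.to_implicitFunction hrange).hasFDerivAt.hasFDerivWithinAt.mapsTo_tangent_cone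
    hmem
  rw [hf.implicitFunction_apply_image hrange] at himage
  exact tangentConeAt_mono (image_subset_iff.2 fun _ hy => hy) himage

/-- Let `c₁, c₂` be continuously differentiable near `x0`, with `D c₁(x0)`
surjective, and suppose `c₂` is constant on `X ∩ V` where `X = {x : c₁ x = c₁ x0}` and `V`
is an open neighborhood of `x0`. With `c = (c₁, c₂)` and `M = {x : c x = c x0}`:
(i) `M ∩ V = X ∩ V`; (ii) `ker D c(x0) = ker D c₁(x0)`; and (iii) the tangent cone of `M`
at `x0` equals `ker D c(x0)` — i.e., the Abadie constraint qualification holds for `c` at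
`x0`. -/
theorem abadie_of_locally_redundant_constraints {n m₁ m₂ : ℕ}
    (c₁ : EuclideanSpace ℝ (Fin n) → EuclideanSpace ℝ (Fin m₁))
    (c₂ : EuclideanSpace ℝ (Fin n) → EuclideanSpace ℝ (Fin m₂))
    (x0 : EuclideanSpace ℝ (Fin n))
    (hc₁ : ContDiffAt ℝ 1 c₁ x0) (hc₂ : ContDiffAt ℝ 1 c₂ x0)
    (hsurj : Function.Surjective ⇑(fderiv ℝ c₁ x0))
    (V : Set (EuclideanSpace ℝ (Fin n))) (hV : IsOpen V) (hx0V : x0 ∈ V)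
    (hloc : ∀ x ∈ {x | c₁ x = c₁ x0} ∩ V, c₂ x = c₂ x0) :
    ({x | (c₁ x, c₂ x) = (c₁ x0, c₂ x0)} ∩ V = {x | c₁ x = c₁ x0} ∩ V) ∧
    (∀ v, fderiv ℝ (fun x => (c₁ x, c₂ x)) x0 v = 0 ↔ fderiv ℝ c₁ x0 v = 0) ∧
    tangentConeAt ℝ {x | (c₁ x, c₂ x) = (c₁ x0, c₂ x0)} x0
      = {v | fderiv ℝ (fun x => (c₁ x, c₂ x)) x0 v = 0} := by
  have hinter : {x | (c₁ x, c₂ x) = (c₁ x0, c₂ x0)} ∩ V = {x | c₁ x = c₁ x0} ∩ V := by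
    ext x
    constructor
    · rintro ⟨hx, hxV⟩
      exact ⟨(Prod.mk.inj hx).1, hxV⟩
    · rintro ⟨hx, hxV⟩
      exact ⟨Prod.ext hx (hloc x ⟨hx, hxV⟩), hxV⟩
  have hd₁ := hc₁.hasStrictFDerivAt one_ne_zero
  have hd := hd₁.hasFDerivAt.prodMk (hc₂.differentiableAt one_ne_zero).hasFDerivAt
  have hcone : ∀ v, fderiv ℝ c₁ x0 v = 0 →
      v ∈ tangentConeAt ℝ {x | (c₁ x, c₂ x) = (c₁ x0, c₂ x0)} x0 := by
    intro v hv
    rw [← tangentConeAt_inter_nhds (hV.mem_nhds hx0V), hinter,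
      tangentConeAt_inter_nhds (hV.mem_nhds hx0V)]
    exact hd₁.mem_tangentConeAt_levelSet hsurj hv
  have hker : ∀ v, fderiv ℝ (fun x => (c₁ x, c₂ x)) x0 v = 0 ↔ fderiv ℝ c₁ x0 v = 0 := by
    intro v
    rw [hd.fderiv]
    exact ⟨fun hv => congrArg Prod.fst hv,
      fun hv => hd.apply_eq_zero_of_mem_tangentConeAt_levelSet (hcone v hv)⟩
  refine ⟨hinter, hker, Subset.antisymm (fun v hv => ?_) fun v hv => hcone v ((hker v).1 hv)⟩
  exact hd.differentiableAt.hasFDerivAt.apply_eq_zero_of_mem_tangentConeAt_levelSet hv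
end
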